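/- arXiv:1507.07727 — 2 statements merged into one kernel-verified Lean document; each statement's English description precedes it below -/
import Mathlib

section
/- Let G = (V, E) be a digraph rooted at a vertex v (v has no incoming edges and every vertex is reachable from v), such that the induced subdigraph G[V∖{v}] is strongly connected and G has no non-trivial dominators (i.e., for every vertex u ≠ v, the only vertex dominated by u is u itself). Then the Kirchhoff polynomial κ(G) is prime: it admits no factorization κ(G) = P·Q with both P and Q non-constant polynomials. -/
open MvPolynomial

/-- A finite directed (multi)graph with abstractly named edges: a finite set of
vertices, a finite set of edge names, and source/target maps.  Edge names double
as the labels/variables of the Kirchhoff polynomial. -/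
structure MultiDigraph (V : Type*) (ε : Type*) where
  verts : Finset V
  edges : Finset ε
  src : ε → V
  tgt : ε → V

namespace MultiDigraph

variable {V : Type*} {ε : Type*} [DecidableEq V] [DecidableEq ε]

/-- One step along an edge of `A`. -/
def Step (G : MultiDigraph V ε) (A : Finset ε) (x y : V) : Prop :=
  ∃ e ∈ A, G.src e = x ∧ G.tgt e = y

/-- Directed reachability using only edges of `A`. -/
def Reaches (G : MultiDigraph V ε) (A : Finset ε) (x y : V) : Prop :=
  Relation.ReflTransGen (G.Step A) x y

/-- Every edge has both of its endpoints among the vertices. -/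
def WellFormed (G : MultiDigraph V ε) : Prop :=
  ∀ e ∈ G.edges, G.src e ∈ G.verts ∧ G.tgt e ∈ G.verts

/-- `G` is a simple digraph: it has no loops and no parallel edges. -/
def Simple (G : MultiDigraph V ε) : Prop :=
  (∀ e ∈ G.edges, G.src e ≠ G.tgt e) ∧
    ∀ e ∈ G.edges, ∀ e' ∈ G.edges, G.src e = G.src e' → G.tgt e = G.tgt e' → e = e'

/-- `A` is (the edge set of) an arborescence of `G` rooted at `r`: a spanning
subdigraph in which every vertex other than the root has exactly one incoming
edge, the root has none, and every vertex is reachable from the root (hence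
along a unique directed path). -/
def IsArbAt (G : MultiDigraph V ε) (A : Finset ε) (r : V) : Prop :=
  A ⊆ G.edges ∧ r ∈ G.verts ∧
  (∀ e ∈ A, G.src e ∈ G.verts ∧ G.tgt e ∈ G.verts) ∧
  (∀ e ∈ A, G.tgt e ≠ r) ∧
  (∀ w ∈ G.verts, w ≠ r → ∃! e, e ∈ A ∧ G.tgt e = w) ∧
  (∀ w ∈ G.verts, G.Reaches A r w)

/-- `A` is an arborescence of `G` (rooted at some vertex). -/
def IsArb (G : MultiDigraph V ε) (A : Finset ε) : Prop :=
  ∃ r, G.IsArbAt A r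

open Classical in
/-- The Kirchhoff polynomial of `G`: the sum, over all arborescences, of the
products of the variables of their edges. -/
noncomputable def kirchhoff (G : MultiDigraph V ε) : MvPolynomial ε ℚ :=
  ∑ A ∈ G.edges.powerset.filter (fun A => G.IsArb A), ∏ e ∈ A, X e

open Classical in
/-- The Kirchhoff polynomial of arborescences of `G` rooted at `r`. -/
noncomputable def kirchhoffAt (G : MultiDigraph V ε) (r : V) : MvPolynomial ε ℚ :=
  ∑ A ∈ G.edges.powerset.filter (fun A => G.IsArbAt A r), ∏ e ∈ A, X e

/-- The incoming edges of vertex `v`. -/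
def inEdges (G : MultiDigraph V ε) (v : V) : Finset ε :=
  G.edges.filter (fun e => G.tgt e = v)

/-- `G` is rooted at `v`: `v` has no incoming edges and every vertex is
reachable from `v`. -/
def RootedAt (G : MultiDigraph V ε) (v : V) : Prop :=
  v ∈ G.verts ∧ (∀ e ∈ G.edges, G.tgt e ≠ v) ∧ ∀ w ∈ G.verts, G.Reaches G.edges v w

/-- `G` is strongly connected. -/
def StronglyConnected (G : MultiDigraph V ε) : Prop :=
  ∀ x ∈ G.verts, ∀ y ∈ G.verts, G.Reaches G.edges x y

/-- `G` is (weakly) connected. -/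
def WeaklyConnected (G : MultiDigraph V ε) : Prop :=
  ∀ x ∈ G.verts, ∀ y ∈ G.verts,
    Relation.ReflTransGen (fun a b => G.Step G.edges a b ∨ G.Step G.edges b a) x y

/-- The induced subdigraph `G[D]`. -/
def induce (G : MultiDigraph V ε) (D : Finset V) : MultiDigraph V ε where
  verts := D
  edges := G.edges.filter (fun e => G.src e ∈ D ∧ G.tgt e ∈ D)
  src := G.src
  tgt := G.tgt

/-- `root_u(G)`: remove all edges incoming to `u`. -/
def rootAt (G : MultiDigraph V ε) (u : V) : MultiDigraph V ε where
  verts := G.verts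
  edges := G.edges.filter (fun e => G.tgt e ≠ u)
  src := G.src
  tgt := G.tgt

/-- Delete a single edge. -/
def deleteEdge (G : MultiDigraph V ε) (e₀ : ε) : MultiDigraph V ε where
  verts := G.verts
  edges := G.edges.erase e₀
  src := G.src
  tgt := G.tgt

/-- The contraction `G(S → u)`: all edges from `Vᶜ∖S` into `S∖{u}` and all edges
inside `S` are removed, and `S` is contracted into the single vertex `u`;
edges retain their names (labels). -/
def contract (G : MultiDigraph V ε) (S : Finset V) (u : V) : MultiDigraph V ε where
  verts := insert u (G.verts \ S)
  edges := G.edges.filter (fun e => G.tgt e ∉ S ∨ (G.src e ∉ S ∧ G.tgt e = u))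
  src := fun e => if G.src e ∈ S then u else G.src e
  tgt := fun e => if G.tgt e ∈ S then u else G.tgt e

/-- Directed walks from `x` to `y`, given as lists of edges taken from `A`. -/
def IsWalk (G : MultiDigraph V ε) (A : Finset ε) : List ε → V → V → Prop
  | [], x, y => x = y
  | e :: p, x, y => e ∈ A ∧ G.src e = x ∧ IsWalk G A p (G.tgt e) y

/-- A simple directed path from `x` to `y` (no repeated vertices). -/
def IsPath (G : MultiDigraph V ε) (A : Finset ε) (p : List ε) (x y : V) : Prop :=
  G.IsWalk A p x y ∧ (x :: p.map G.tgt).Nodup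

/-- A simple directed cycle through `x` (no repeated vertices). -/
def IsCycle (G : MultiDigraph V ε) (A : Finset ε) (p : List ε) (x : V) : Prop :=
  p ≠ [] ∧ G.IsWalk A p x x ∧ (p.map G.tgt).Nodup

/-- The edge set `A` contains no directed cycle. -/
def Acyclic (G : MultiDigraph V ε) (A : Finset ε) : Prop :=
  ¬ ∃ p x, G.IsCycle A p x

/-- In `G` rooted at `v`, vertex `u` dominates vertex `w`: every directed path
from `v` to `w` passes through `u`. -/
def Dominates (G : MultiDigraph V ε) (v u w : V) : Prop :=
  ∀ p : List ε, G.IsPath G.edges p v w → u ∈ v :: p.map G.tgt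

open Classical in
/-- `dom_G(u)` (w.r.t. the root `v`): the set of all vertices dominated by `u`. -/
noncomputable def domSet (G : MultiDigraph V ε) (v u : V) : Finset V :=
  G.verts.filter (fun w => G.Dominates v u w)

/-- In `G` rooted at `v`, `y` is an immediate dominator of `z`. -/
def ImmDominates (G : MultiDigraph V ε) (v y z : V) : Prop :=
  y ≠ z ∧ G.Dominates v y z ∧
    ∀ x ∈ G.verts, x ≠ y → x ≠ z → G.Dominates v x z → G.Dominates v x y

open Classical in
/-- `imm_G(y)` (w.r.t. the root `v`): the set of vertices immediately dominated by `y`. -/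
noncomputable def immSet (G : MultiDigraph V ε) (v y : V) : Finset V :=
  G.verts.filter (fun z => G.ImmDominates v y z)

open Classical in
/-- The simultaneous contraction `G(dom(z₁) → z₁; …; dom(z_i) → z_i)` for
`Z = {z₁, …, z_i}` (domination w.r.t. the root `v`). -/
noncomputable def domContract (G : MultiDigraph V ε) (v : V) (Z : Finset V) :
    MultiDigraph V ε where
  verts := G.verts.filter (fun x => ∀ z ∈ Z, G.Dominates v z x → x = z)
  edges := G.edges.filter (fun e =>
    (∀ z ∈ Z, ¬(G.Dominates v z (G.src e) ∧ G.Dominates v z (G.tgt e))) ∧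
    (∀ z ∈ Z, ¬(¬ G.Dominates v z (G.src e) ∧ G.Dominates v z (G.tgt e) ∧ G.tgt e ≠ z)))
  src := fun e =>
    if h : ∃ z ∈ Z, G.Dominates v z (G.src e) ∧ G.src e ≠ z then h.choose else G.src e
  tgt := fun e =>
    if h : ∃ z ∈ Z, G.Dominates v z (G.tgt e) ∧ G.tgt e ≠ z then h.choose else G.tgt e

/-- Mutual directed reachability in `G`. -/
def MutuallyReachable (G : MultiDigraph V ε) (x y : V) : Prop :=
  G.Reaches G.edges x y ∧ G.Reaches G.edges y x

open Classical in
/-- `W` is (the vertex set of) a strongly connected component of `G`, i.e. an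
equivalence class of mutual reachability. -/
def IsSCC (G : MultiDigraph V ε) (W : Finset V) : Prop :=
  ∃ x ∈ G.verts, W = G.verts.filter (fun y => G.MutuallyReachable x y)

/-- `W` is a minimal element in the partial order that reachability induces on
the strongly connected components of `G` (an initial SCC). -/
def IsMinimalSCC (G : MultiDigraph V ε) (W : Finset V) : Prop :=
  G.IsSCC W ∧ ∀ W', G.IsSCC W' → (∃ x ∈ W', ∃ y ∈ W, G.Reaches G.edges x y) → W' = W

open Classical in
/-- The digraph `Ĝ(W)` associated with a strongly connected component `G[W]`:
if `G[W]` has no incoming edges (it is the initial SCC) it is `G[W]` itself;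
otherwise a new auxiliary vertex (here `none`) is added and every edge of `G`
entering `W` from outside is redirected to start at the auxiliary vertex,
keeping its label. -/
noncomputable def hatSCC (G : MultiDigraph V ε) (W : Finset V) :
    MultiDigraph (Option V) ε where
  verts :=
    if ∃ e ∈ G.edges, G.tgt e ∈ W ∧ G.src e ∉ W then insert none (W.image some)
    else W.image some
  edges := G.edges.filter (fun e => G.tgt e ∈ W)
  src := fun e => if G.src e ∈ W then some (G.src e) else none
  tgt := fun e => some (G.tgt e)

/-- `u` is an independent vertex of the simple directed cycle `C` (w.r.t. the
root `v`): `u` lies on `C` and there is a simple directed path from `v` to `u`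
which is vertex-disjoint from `C` except at `u`. -/
def IsIndependentVertex (G : MultiDigraph V ε) (v : V) (C : List ε) (u : V) : Prop :=
  u ∈ C.map G.tgt ∧ ∃ p, G.IsPath G.edges p v u ∧
    ∀ z ∈ v :: p.map G.tgt, z ∈ C.map G.tgt → z = u

end MultiDigraph

open MvPolynomial

namespace MultiDigraph

section Relation

variable {α : Type*} (R : α → α → Prop)

/-- Reachability along `R` by steps that all end in `P`. -/
def ReachIn (P : Set α) : α → α → Prop :=
  Relation.ReflTransGen (fun a b => R a b ∧ b ∈ P)

/-- `P` carries walks from `v` through each of its vertices and on to `K`. -/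
structure Connects (v : α) (P K : Set α) : Prop where
  nonempty : P.Nonempty
  reach : ∀ r ∈ P, ReachIn R P v r
  exit : ∀ r ∈ P, ∃ y ∈ P, ReachIn R P r y ∧ ∃ k ∈ K, R y k

variable {R} {P Q B K Z : Set α} {a b k v w x y z : α}

namespace ReachIn

theorem mono (h : ReachIn R P a b) (hPQ : P ⊆ Q) : ReachIn R Q a b :=
  Relation.ReflTransGen.mono (fun _ _ hab => ⟨hab.1, hPQ hab.2⟩) a b h

theorem trans (h₁ : ReachIn R P a b) (h₂ : ReachIn R P b x) : ReachIn R P a x :=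
  Relation.ReflTransGen.trans h₁ h₂

theorem tail (h₁ : ReachIn R P a b) (h₂ : R b x) (hx : x ∈ P) : ReachIn R P a x :=
  Relation.ReflTransGen.tail h₁ ⟨h₂, hx⟩

theorem eq_or_mem (h : ReachIn R P a b) : b = a ∨ b ∈ P := by
  rcases Relation.ReflTransGen.cases_tail h with h | ⟨c, -, h⟩
  · exact Or.inl h
  · exact Or.inr h.2

/-- A walk that starts outside `K` and ends in `K` first enters `K` along some edge. -/
theorem exists_first_entry (h : ReachIn R B a b) (ha : a ∉ K) (hb : b ∈ K) :
    ∃ x y, ReachIn R (B \ K) a x ∧ R x y ∧ y ∈ K := by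
  induction h using Relation.ReflTransGen.head_induction_on with
  | refl => exact absurd hb ha
  | @head a c hac _ ih =>
    by_cases hc : c ∈ K
    · exact ⟨a, c, .refl, hac.1, hc⟩
    · obtain ⟨x, y, hx, hxy⟩ := ih hc
      exact ⟨x, y, Relation.ReflTransGen.head ⟨hac.1, hac.2, hc⟩ hx, hxy⟩

/-- A walk that starts in `Z` leaves `Z` for the last time at some vertex. -/
theorem exists_last_exit (h : ReachIn R B a b) (ha : a ∈ Z) :
    ∃ z ∈ Z, ReachIn R (B \ Z) z b := by
  induction h with
  | refl => exact ⟨a, ha, .refl⟩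
  | @tail b c _ hbc ih =>
    by_cases hc : c ∈ Z
    · exact ⟨c, hc, .refl⟩
    · obtain ⟨z, hz, hzb⟩ := ih
      exact ⟨z, hz, hzb.tail hbc.1 ⟨hbc.2, hc⟩⟩

/-- A walk from `a` to `b` only visits vertices that lie between `a` and `b`. -/
theorem between (h : ReachIn R P a b) (hv : ReachIn R P v a) (hw : ReachIn R P b w) :
    ReachIn R {r ∈ P | ReachIn R P v r ∧ ReachIn R P r w} a b := by
  induction h with
  | refl => exact .refl
  | @tail b c hab hbc ih =>
    exact (ih (Relation.ReflTransGen.head hbc hw)).tail hbc.1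
      ⟨hbc.2, (hv.trans hab).tail hbc.1 hbc.2, hw⟩

end ReachIn

/-- Restrict a walk's ambient set to the vertices which lie on walks. -/
theorem exists_connects (hy : y ∈ P) (hvy : ReachIn R P v y) (hk : k ∈ K) (hyk : R y k) :
    ∃ P' ⊆ P, Connects R v P' K := by
  refine ⟨{r ∈ P | ReachIn R P v r ∧ ReachIn R P r y}, fun r hr => hr.1,
    ⟨y, hy, hvy, .refl⟩, fun r hr => hr.2.1.between .refl hr.2.2, fun r hr =>
      ⟨y, ⟨hy, hvy, .refl⟩, hr.2.2.between hr.2.1 .refl, k, hk, hyk⟩⟩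

theorem exists_connects_pair {P' : Set α} {y' k' : α} (hPQ : Disjoint P Q)
    (hP : P ⊆ P') (hQ : Q ⊆ P')
    (hy : y ∈ P) (hvy : ReachIn R P v y) (hk : k ∈ K) (hyk : R y k)
    (hy' : y' ∈ Q) (hvy' : ReachIn R Q v y') (hk' : k' ∈ K) (hyk' : R y' k') :
    ∃ P₁ ⊆ P', ∃ P₂ ⊆ P', Disjoint P₁ P₂ ∧ Connects R v P₁ K ∧ Connects R v P₂ K := by
  obtain ⟨P₁, h₁, hc₁⟩ := exists_connects hy hvy hk hyk
  obtain ⟨P₂, h₂, hc₂⟩ := exists_connects hy' hvy' hk' hyk'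
  exact ⟨P₁, h₁.trans hP, P₂, h₂.trans hQ, hPQ.mono h₁ h₂, hc₁, hc₂⟩

/-- Two disjoint connections from `v` to `w → k` can be rerouted if some walk from `v` to
`K` avoids `w`. -/
theorem exists_reroute (hwK : w ∉ K) (hwB : w ∈ B)
    (hPQ : Disjoint P Q) (hP : P ⊆ B \ insert w K) (hQ : Q ⊆ B \ insert w K)
    (hPr : ∀ r ∈ P, ReachIn R P v r) (hwk : R w k) (hk : k ∈ K)
    {q : α} (hvq : ReachIn R Q v q) (hqw : R q w)
    (hz : z = v ∨ z ∈ P) (hzx : ReachIn R ((B \ insert w K) \ insert v (P ∪ Q)) z x)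
    (hxv : x ≠ v) (hxy : R x y) (hy : y ∈ K) :
    ∃ P₁ ⊆ B \ K, ∃ P₂ ⊆ B \ K, Disjoint P₁ P₂ ∧ Connects R v P₁ K ∧ Connects R v P₂ K := by
  have hvz : ReachIn R P v z := by
    rcases hz with rfl | hz
    · exact .refl
    · exact hPr z hz
  have hsub : B \ insert w K ⊆ B \ K := Set.sdiff_subset_sdiff_right (Set.subset_insert _ _)
  refine exists_connects_pair (P := P ∪ ((B \ insert w K) \ insert v (P ∪ Q)))
    (Q := insert w Q) ?_ ?_ ?_ ?_
    ((hvz.mono Set.subset_union_left).trans (hzx.mono Set.subset_union_right)) hy hxy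
    (Set.mem_insert _ _) ((hvq.mono (Set.subset_insert _ _)).tail hqw (Set.mem_insert _ _))
    hk hwk
  · rw [Set.disjoint_left] at hPQ ⊢
    rintro r (hr | hr) (rfl | hr')
    · exact (hP hr).2 (Set.mem_insert _ _)
    · exact hPQ hr hr'
    · exact hr.1.2 (Set.mem_insert _ _)
    · exact hr.2 (Or.inr (Or.inr hr'))
  · exact Set.union_subset (hP.trans hsub) (Set.sdiff_subset.trans hsub)
  · exact Set.insert_subset ⟨hwB, hwK⟩ (hQ.trans hsub)
  · rcases hzx.eq_or_mem with rfl | hx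
    · exact Or.inl (hz.resolve_left hxv)
    · exact Or.inr hx

/-- If no single vertex separates `v` from another vertex, every nonempty set `K` either
contains an out-neighbour of `v` or is joined to `v` by two disjoint connections. -/
theorem exists_disjoint_connects (hB : B.Finite) (hv : v ∉ B)
    (hreach : ∀ k ∈ B, ReachIn R B v k)
    (hsep : ∀ z ∈ B, ∀ k ∈ B, k ≠ z → ReachIn R (B \ {z}) v k)
    (K : Set α) (hKB : K ⊆ B) (hK : K.Nonempty) (hvK : ∀ k ∈ K, ¬ R v k) :
    ∃ P ⊆ B \ K, ∃ Q ⊆ B \ K, Disjoint P Q ∧ Connects R v P K ∧ Connects R v Q K := by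
  induction hn : (B \ K).ncard using Nat.strong_induction_on generalizing K with
  | _ n ih =>
  obtain ⟨k₀, hk₀⟩ := hK
  have hvnK : v ∉ K := fun h => hv (hKB h)
  obtain ⟨w, k, hw, hwk, hk⟩ := (hreach k₀ (hKB hk₀)).exists_first_entry hvnK hk₀
  have hwBK : w ∈ B \ K := hw.eq_or_mem.resolve_left fun h => hvK k hk (h ▸ hwk)
  have hav := hsep w hwBK.1 k (hKB hk) fun h => hwBK.2 (h ▸ hk)
  obtain ⟨x, y, hx, hxy, hy⟩ := hav.exists_first_entry hvnK hk
  have hxv : x ≠ v := fun h => hvK y hy (h ▸ hxy)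
  have heq : (B \ {w}) \ K = B \ insert w K := by
    rw [Set.sdiff_sdiff, Set.singleton_union]
  rw [heq] at hx
  have hsub : B \ insert w K ⊆ B \ K := Set.sdiff_subset_sdiff_right (Set.subset_insert _ _)
  by_cases hvw : R v w
  · refine exists_connects_pair (P := B \ insert w K) (Q := {w}) ?_ hsub
      (Set.singleton_subset_iff.2 hwBK) (hx.eq_or_mem.resolve_left hxv) hx hy hxy
      rfl (Relation.ReflTransGen.single ⟨hvw, rfl⟩) hk hwk
    rw [Set.disjoint_singleton_right]
    exact fun h => h.2 (Set.mem_insert _ _)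
  · have hlt : (B \ insert w K).ncard < n := by
      rw [← hn]
      exact Set.ncard_lt_ncard ⟨hsub, fun h => (h hwBK).2 (Set.mem_insert _ _)⟩
        (hB.subset Set.sdiff_subset)
    obtain ⟨P, hP, Q, hQ, hPQ, hcP, hcQ⟩ := ih _ hlt (insert w K)
      (Set.insert_subset hwBK.1 hKB) (Set.insert_nonempty _ _)
      (by rintro _ (rfl | h); exacts [hvw, hvK _ h]) rfl
    have hQP := hPQ.symm
    obtain ⟨p₀, hp₀⟩ := hcP.nonempty
    obtain ⟨p, hp, -, p', hp', hpp'⟩ := hcP.exit p₀ hp₀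
    obtain ⟨q₀, hq₀⟩ := hcQ.nonempty
    obtain ⟨q, hq, -, q', hq', hqq'⟩ := hcQ.exit q₀ hq₀
    have hwP : w ∉ P := fun h => (hP h).2 (Set.mem_insert _ _)
    have hwQ : w ∉ Q := fun h => (hQ h).2 (Set.mem_insert _ _)
    have hins : ∀ {S : Set α}, S ⊆ B \ insert w K → insert w S ⊆ B \ K := fun hS =>
      Set.insert_subset hwBK (hS.trans hsub)
    rcases hp' with rfl | hp' <;> rcases hq' with rfl | hq'
    · obtain ⟨z, hz, hzx⟩ := hx.exists_last_exit (Z := insert v (P ∪ Q)) (Set.mem_insert _ _)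
      by_cases hzQ : z ∈ Q
      · rw [Set.union_comm] at hzx
        exact exists_reroute hwBK.2 hwBK.1 hQP hQ hP hcQ.reach hwk hk (hcP.reach p hp)
          hpp' (Or.inr hzQ) hzx hxv hxy hy
      · refine exists_reroute hwBK.2 hwBK.1 hPQ hP hQ hcP.reach hwk hk (hcQ.reach q hq)
          hqq' ?_ hzx hxv hxy hy
        rcases hz with hz | hz | hz
        exacts [Or.inl hz, Or.inr hz, absurd hz hzQ]
    · exact exists_connects_pair (P := insert p' P)
        (Set.disjoint_insert_left.2 ⟨hwQ, hPQ⟩) (hins hP) (hQ.trans hsub)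
        (Set.mem_insert _ _)
        (((hcP.reach p hp).mono (Set.subset_insert _ _)).tail hpp' (Set.mem_insert _ _)) hk hwk
        hq (hcQ.reach q hq) hq' hqq'
    · exact exists_connects_pair (Q := insert q' Q)
        (Set.disjoint_insert_right.2 ⟨hwP, hPQ⟩) (hP.trans hsub) (hins hQ)
        hp (hcP.reach p hp) hp' hpp'
        (Set.mem_insert _ _)
        (((hcQ.reach q hq).mono (Set.subset_insert _ _)).tail hqq' (Set.mem_insert _ _)) hk hwk
    · exact exists_connects_pair hPQ (hP.trans hsub) (hQ.trans hsub)
        hp (hcP.reach p hp) hp' hpp' hq (hcQ.reach q hq) hq' hqq'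

/-- Any two vertices of `K` are joined by a walk inside `K`. -/
def StrongIn (R : α → α → Prop) (K : Set α) : Prop :=
  ∀ x ∈ K, ∀ y ∈ K, ReachIn R K x y

/-- `u` is a vertex of `K` at which some walk from `v` inside `B` first enters `K`. -/
def IsEntry (R : α → α → Prop) (v : α) (B K : Set α) (u : α) : Prop :=
  u ∈ K ∧ ∃ x, ReachIn R (B \ K) v x ∧ R x u

/-- The strongly connected component of `k` inside `B`. -/
theorem strongIn_component (B : Set α) (k : α) :
    StrongIn R {r ∈ B | ReachIn R B k r ∧ ReachIn R B r k} := by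
  intro x hx y hy
  exact (hx.2.2.between hx.2.1 .refl).trans (hy.2.1.between .refl hy.2.2)

/-- A strongly connected set that contains no out-neighbour of `v` can be enlarged keeping one
of its entries. -/
theorem exists_larger_strongIn (hB : B.Finite) (hv : v ∉ B)
    (hreach : ∀ k ∈ B, ReachIn R B v k)
    (hsep : ∀ z ∈ B, ∀ k ∈ B, k ≠ z → ReachIn R (B \ {z}) v k) (hsB : StrongIn R B)
    (hKB : K ⊆ B) (hK : K.Nonempty) (hvK : ∀ k ∈ K, ¬ R v k) (hsK : StrongIn R K) :
    ∃ K' ⊆ B, K ⊂ K' ∧ StrongIn R K' ∧ ∃ u, IsEntry R v B K u ∧ IsEntry R v B K' u := by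
  obtain ⟨P, hP, Q, hQ, hPQ, hcP, hcQ⟩ :=
    exists_disjoint_connects hB hv hreach hsep K hKB hK hvK
  obtain ⟨k, hk⟩ := hK
  have aux : ∀ P Q : Set α, P ⊆ B \ K → Q ⊆ B \ K → Disjoint P Q → Connects R v P K →
      Connects R v Q K → ∀ x m, ReachIn R (B \ (P ∪ Q)) k x → R x m → m ∈ P →
      ∃ K' ⊆ B, K ⊂ K' ∧ StrongIn R K' ∧ ∃ u, IsEntry R v B K u ∧ IsEntry R v B K' u := by
    intro P Q hP hQ hPQ hcP hcQ x m hx hxm hm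
    have hPBQ : P ⊆ B \ Q := fun r hr => ⟨(hP hr).1, Set.disjoint_left.1 hPQ hr⟩
    have hKBQ : K ⊆ B \ Q := fun r hr => ⟨hKB hr, fun h => (hQ h).2 hr⟩
    have hKsub : K ⊆ {r ∈ B \ Q | ReachIn R (B \ Q) k r ∧ ReachIn R (B \ Q) r k} :=
      fun r hr => ⟨hKBQ hr, (hsK k hk r hr).mono hKBQ, (hsK r hr k hk).mono hKBQ⟩
    refine ⟨_, fun r hr => hr.1.1, ⟨hKsub, fun h => ?_⟩, strongIn_component (B \ Q) k, ?_⟩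
    · obtain ⟨y, -, hmy, k', hk', hyk'⟩ := hcP.exit m hm
      have hBPQ : B \ (P ∪ Q) ⊆ B \ Q := Set.sdiff_subset_sdiff_right Set.subset_union_right
      exact (hP hm).2 (h ⟨hPBQ hm, (hx.mono hBPQ).tail hxm (hPBQ hm),
        ((hmy.mono hPBQ).tail hyk' (hKBQ hk')).trans ((hsK k' hk' k hk).mono hKBQ)⟩)
    · obtain ⟨q₀, hq₀⟩ := hcQ.nonempty
      obtain ⟨q, hq, -, u, hu, hqu⟩ := hcQ.exit q₀ hq₀
      exact ⟨u, ⟨hu, q, (hcQ.reach q hq).mono hQ, hqu⟩, hKsub hu, q,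
        (hcQ.reach q hq).mono fun r hr => ⟨(hQ hr).1, fun h => h.1.2 hr⟩, hqu⟩
  obtain ⟨p, hp⟩ := hcP.nonempty
  obtain ⟨x, m, hx, hxm, hm | hm⟩ :=
    (hsB k (hKB hk) p (hP hp).1).exists_first_entry (K := P ∪ Q)
      (fun h => h.elim (fun h => (hP h).2 hk) fun h => (hQ h).2 hk) (Or.inl hp)
  · exact aux P Q hP hQ hPQ hcP hcQ x m hx hxm hm
  · rw [Set.union_comm] at hx
    exact aux Q P hQ hP hPQ.symm hcQ hcP x m hx hxm hm

/-- A vertex set that contains all or none of the entries of each strongly connected set is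
everything or nothing. -/
theorem mem_of_mem_of_entries (hB : B.Finite) (hv : v ∉ B)
    (hreach : ∀ k ∈ B, ReachIn R B v k)
    (hsep : ∀ z ∈ B, ∀ k ∈ B, k ≠ z → ReachIn R (B \ {z}) v k) (hsB : StrongIn R B)
    (S : Set α)
    (hS : ∀ K ⊆ B, StrongIn R K → ∀ u w, IsEntry R v B K u → IsEntry R v B K w →
      u ∈ S → w ∈ S)
    {s t : α} (hs : s ∈ B) (ht : t ∈ B) (hsS : s ∈ S) : t ∈ S := by
  have hS' : ∀ K ⊆ B, StrongIn R K → ∀ u w, IsEntry R v B K u → IsEntry R v B K w →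
      (u ∈ S ↔ w ∈ S) := fun K hK hK' u w hu hw => ⟨hS K hK hK' u w hu hw, hS K hK hK' w u hw hu⟩
  obtain ⟨x, n, hx, hn, hnB⟩ := (hreach s hs).exists_first_entry hv hs
  have hxv : x = v := by
    rcases hx.eq_or_mem with h | h
    · exact h
    · exact absurd h.1 h.2
  subst hxv
  have key : ∀ K ⊆ B, StrongIn R K → ∀ u, IsEntry R x B K u → (u ∈ S ↔ n ∈ S) := by
    intro K hKB hsK u hu
    induction hm : (B \ K).ncard using Nat.strong_induction_on generalizing K u with
    | _ m ih =>
    by_cases hvK : ∃ k ∈ K, R x k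
    · obtain ⟨k, hk, hvk⟩ := hvK
      exact (hS' K hKB hsK u k hu ⟨hk, x, .refl, hvk⟩).trans
        (hS' B subset_rfl hsB k n ⟨hKB hk, x, .refl, hvk⟩ ⟨hnB, x, .refl, hn⟩)
    · push Not at hvK
      obtain ⟨K', hK'B, hlt, hsK', w, hw, hw'⟩ :=
        exists_larger_strongIn hB hv hreach hsep hsB hKB ⟨u, hu.1⟩ hvK hsK
      refine (hS' K hKB hsK u w hu hw).trans (ih _ ?_ K' hK'B hsK' w hw' rfl)
      rw [← hm]
      obtain ⟨r, hr, hrK⟩ := Set.exists_of_ssubset hlt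
      exact Set.ncard_lt_ncard ⟨Set.sdiff_subset_sdiff_right hlt.subset,
        fun h => (h ⟨hK'B hr, hrK⟩).2 hr⟩ (hB.subset Set.sdiff_subset)
  have hpt : ∀ r ∈ B, (r ∈ S ↔ n ∈ S) := by
    intro r hr
    obtain ⟨y, r', hy, hyr, rfl⟩ := (hreach r hr).exists_first_entry (K := {r})
      (fun h => hv (h ▸ hr)) rfl
    refine key {r'} (Set.singleton_subset_iff.2 hr) ?_ r' ⟨rfl, y, hy, hyr⟩
    rintro _ rfl _ rfl
    exact .refl
  exact (hpt t ht).2 ((hpt s hs).1 hsS)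

end Relation
end MultiDigraph

namespace MultiDigraph

section Arborescence

variable {V : Type*} {ε : Type*} {G : MultiDigraph V ε} {v : V}

/-- An edge set from which all vertices are reachable contains an arborescence. -/
theorem exists_isArbAt_subset (hwf : G.WellFormed) (hroot : G.RootedAt v) {E : Finset ε}
    (hE : E ⊆ G.edges) (hreach : ∀ w ∈ G.verts, G.Reaches E v w) :
    ∃ A ⊆ E, G.IsArbAt A v := by
  classical
  let L : ℕ → V → Prop := fun n =>
    Nat.rec (fun x => x = v) (fun _ p x => ∃ e ∈ E, p (G.src e) ∧ G.tgt e = x) n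
  have hL : ∀ w ∈ G.verts, ∃ n, L n w := by
    intro w hw
    have h := hreach w hw
    clear hw
    induction h with
    | refl => exact ⟨0, rfl⟩
    | tail _ hbc ih =>
      obtain ⟨n, hn⟩ := ih
      obtain ⟨e, he, rfl, rfl⟩ := hbc
      exact ⟨n + 1, e, he, hn, rfl⟩
  let d : V → ℕ := fun w => sInf {n | L n w}
  have hd : ∀ n w, L n w → d w ≤ n := fun n w h => Nat.sInf_le h
  have hpar : ∀ w : {x // x ∈ G.verts.erase v}, ∃ e ∈ E, G.tgt e = w ∧ d (G.src e) < d w := by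
    rintro ⟨w, hw⟩
    rw [Finset.mem_erase] at hw
    have hspec : L (d w) w := Nat.sInf_mem (hL w hw.2)
    rcases hm : d w with _ | m
    · rw [hm] at hspec
      exact absurd hspec hw.1
    · rw [hm] at hspec
      obtain ⟨e, he, hsrc, htgt⟩ := hspec
      exact ⟨e, he, htgt, Nat.lt_succ_of_le (hd m _ hsrc)⟩
  choose f hfE hft hfd using hpar
  have hmem : ∀ e, e ∈ Finset.univ.image f ↔ ∃ w, f w = e := by simp
  have hsub : Finset.univ.image f ⊆ E := by
    intro e he
    obtain ⟨w, rfl⟩ := (hmem e).1 he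
    exact hfE w
  refine ⟨Finset.univ.image f, hsub, hsub.trans hE, hroot.1, fun e he => hwf e (hE (hsub he)),
    fun e he => hroot.2.1 e (hE (hsub he)), ?_, ?_⟩
  · intro w hw hwv
    refine ⟨f ⟨w, Finset.mem_erase.2 ⟨hwv, hw⟩⟩, ⟨(hmem _).2 ⟨_, rfl⟩, hft _⟩, ?_⟩
    rintro e ⟨he, rfl⟩
    obtain ⟨w', rfl⟩ := (hmem e).1 he
    congr 1
    exact Subtype.ext (hft w').symm
  · intro w hw
    induction hn : d w using Nat.strong_induction_on generalizing w with
    | _ n ih =>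
    by_cases hwv : w = v
    · subst hwv; exact .refl
    · have hw' := Finset.mem_erase.2 ⟨hwv, hw⟩
      refine Relation.ReflTransGen.tail (ih _ (hn ▸ hfd ⟨w, hw'⟩) (G.src (f ⟨w, hw'⟩))
        (hwf _ (hE (hfE _))).1 rfl) ⟨f ⟨w, hw'⟩, (hmem _).2 ⟨_, rfl⟩, rfl, hft _⟩

/-- An entry `u` of a strongly connected set `K` is the only vertex of `K` entered from outside
by some arborescence. -/
theorem exists_isArbAt_of_isEntry (hwf : G.WellFormed) (hroot : G.RootedAt v) {K : Set V}
    (hsK : StrongIn (G.Step G.edges) K) {B : Set V} {u : V}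
    (hu : IsEntry (G.Step G.edges) v B K u) :
    ∃ A, G.IsArbAt A v ∧ ∀ e ∈ A, G.tgt e ∈ K → G.tgt e ≠ u → G.src e ∈ K := by
  classical
  let E := G.edges.filter fun e => G.tgt e ∈ K → G.tgt e ≠ u → G.src e ∈ K
  have hEu : G.Reaches E v u := by
    obtain ⟨-, x, hx, e, he, rfl, rfl⟩ := hu
    refine Relation.ReflTransGen.tail ?_
      ⟨e, Finset.mem_filter.2 ⟨he, fun _ h => absurd rfl h⟩, rfl, rfl⟩
    refine Relation.ReflTransGen.mono ?_ _ _ hx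
    rintro _ _ ⟨⟨e, he, rfl, rfl⟩, hb⟩
    exact ⟨e, Finset.mem_filter.2 ⟨he, fun h => absurd h hb.2⟩, rfl, rfl⟩
  have hEK : ∀ k ∈ K, G.Reaches E v k := by
    intro k hk
    have huk := hsK u hu.1 k hk
    clear hk
    have : G.Reaches E v k ∧ k ∈ K := by
      induction huk with
      | refl => exact ⟨hEu, hu.1⟩
      | tail _ hbc ih =>
        obtain ⟨⟨e, he, rfl, rfl⟩, hc⟩ := hbc
        exact ⟨Relation.ReflTransGen.tail ih.1
          ⟨e, Finset.mem_filter.2 ⟨he, fun _ _ => ih.2⟩, rfl, rfl⟩, hc⟩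
    exact this.1
  obtain ⟨A, hAE, hA⟩ := exists_isArbAt_subset hwf hroot (E := E) (Finset.filter_subset _ _) (by
    intro w hw
    have h := hroot.2.2 w hw
    clear hw
    induction h with
    | refl => exact .refl
    | @tail b c _ hbc ih =>
      by_cases hc : c ∈ K
      · exact hEK c hc
      · obtain ⟨e, he, rfl, rfl⟩ := hbc
        exact Relation.ReflTransGen.tail ih
          ⟨e, Finset.mem_filter.2 ⟨he, fun h => absurd h hc⟩, rfl, rfl⟩)
  exact ⟨A, hA, fun e he => (Finset.mem_filter.1 (hAE he)).2⟩

/-- An arborescence enters every vertex set that does not contain its root. -/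
theorem IsArbAt.exists_entering {A : Finset ε} (hA : G.IsArbAt A v) {K : Set V} (hv : v ∉ K)
    {k : V} (hk : k ∈ K) (hkG : k ∈ G.verts) : ∃ e ∈ A, G.tgt e ∈ K ∧ G.src e ∉ K := by
  by_contra! hcon
  have h := hA.2.2.2.2.2 k hkG
  clear hkG
  induction h with
  | refl => exact hv hk
  | tail _ hbc ih =>
    obtain ⟨e, he, rfl, rfl⟩ := hbc
    exact ih (hcon e he hk)

theorem IsWalk.reachIn {A : Finset ε} {B : Set V} {p : List ε} {x y : V}
    (h : G.IsWalk A p x y) (hB : ∀ e ∈ p, e ∈ A → G.tgt e ∈ B) :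
    ReachIn (G.Step A) B x y := by
  induction p generalizing x with
  | nil => obtain rfl : x = y := h; exact .refl
  | cons e p ih =>
    obtain ⟨he, rfl, hp⟩ := h
    exact Relation.ReflTransGen.head ⟨⟨e, he, rfl, rfl⟩, hB e (by simp) he⟩
      (ih hp fun e' he' => hB e' (by simp [he']))

/-- If the in-edges of `S` and those of its complement can be exchanged freely between
arborescences, then `S` contains all non-root vertices or none. -/
theorem mem_of_exchange [DecidableEq V] (hwf : G.WellFormed) (hroot : G.RootedAt v)
    (hsc : (G.induce (G.verts.erase v)).StronglyConnected)
    (hdom : ∀ u ∈ G.verts, u ≠ v → ∀ w ∈ G.verts, G.Dominates v u w → w = u) (S : Set V)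
    (hS : ∀ A A', G.IsArbAt A v → G.IsArbAt A' v → ∃ M, G.IsArbAt M v ∧
      ∀ e ∈ M, (G.tgt e ∈ S → e ∈ A) ∧ (G.tgt e ∉ S → e ∈ A'))
    {s t : V} (hs : s ∈ G.verts) (hsv : s ≠ v) (ht : t ∈ G.verts) (htv : t ≠ v)
    (hsS : s ∈ S) : t ∈ S := by
  have htgt : ∀ e ∈ G.edges, G.tgt e ∈ (G.verts.erase v : Set V) := fun e he =>
    Finset.mem_coe.2 (Finset.mem_erase.2 ⟨hroot.2.1 e he, (hwf e he).2⟩)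
  have hmem : ∀ {x : V}, x ∈ (G.verts.erase v : Set V) ↔ x ≠ v ∧ x ∈ G.verts := by
    intro x
    rw [Finset.mem_coe, Finset.mem_erase]
  refine mem_of_mem_of_entries (R := G.Step G.edges) (v := v)
    (B := (G.verts.erase v : Set V)) (Finset.finite_toSet _) (fun h => (hmem.1 h).1 rfl)
    ?_ ?_ ?_ S ?_ (hmem.2 ⟨hsv, hs⟩) (hmem.2 ⟨htv, ht⟩) hsS
  · intro k hk
    refine Relation.ReflTransGen.mono ?_ _ _ (hroot.2.2 k (hmem.1 hk).2)
    rintro _ _ ⟨e, he, rfl, rfl⟩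
    exact ⟨⟨e, he, rfl, rfl⟩, htgt e he⟩
  · intro z hz k hk hkz
    have h : ¬ G.Dominates v z k := fun h =>
      hkz (hdom z (hmem.1 hz).2 (hmem.1 hz).1 k (hmem.1 hk).2 h)
    simp only [Dominates, not_forall] at h
    obtain ⟨p, hp, hzp⟩ := h
    refine hp.1.reachIn fun e he heG => ⟨htgt e heG, fun h => hzp ?_⟩
    rw [← Set.mem_singleton_iff.1 h]
    exact List.mem_cons_of_mem _ (List.mem_map_of_mem he)
  · intro x hx y hy
    refine Relation.ReflTransGen.mono ?_ _ _ (hsc x (Finset.mem_coe.1 hx) y (Finset.mem_coe.1 hy))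
    rintro _ _ ⟨e, he, rfl, rfl⟩
    have he' := (Finset.mem_filter.1 he).1
    exact ⟨⟨e, he', rfl, rfl⟩, htgt e he'⟩
  · intro K hKB hsK u w hu hw huS
    by_contra hwS
    obtain ⟨A, hA, hAK⟩ := exists_isArbAt_of_isEntry hwf hroot hsK hw
    obtain ⟨A', hA', hAK'⟩ := exists_isArbAt_of_isEntry hwf hroot hsK hu
    obtain ⟨M, hM, hMe⟩ := hS A A' hA hA'
    obtain ⟨e, he, heK, heK'⟩ := hM.exists_entering (fun h => (hmem.1 (hKB h)).1 rfl) hu.1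
      (hmem.1 (hKB hu.1)).2
    by_cases heS : G.tgt e ∈ S
    · exact heK' (hAK e ((hMe e he).1 heS) heK fun h => hwS (h ▸ heS))
    · exact heK' (hAK' e ((hMe e he).2 heS) heK fun h => heS (h ▸ huS))

end Arborescence

section Polynomial

open MvPolynomial

variable {σ : Type*}

/-- The support of a product of polynomials in disjoint sets of variables contains all sums of
exponents. -/
theorem add_mem_support_mul {P Q : MvPolynomial σ ℚ} (hPQ : Disjoint P.vars Q.vars)
    {m n : σ →₀ ℕ} (hm : m ∈ P.support) (hn : n ∈ Q.support) :
    m + n ∈ (P * Q).support := by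
  classical
  have hzP : ∀ m' ∈ P.support, ∀ i, m' i ≠ 0 → i ∈ P.vars := fun m' hm' i hi =>
    (mem_vars_iff_mem_support i).2 ⟨m', hm', Finsupp.mem_support_iff.2 hi⟩
  have hzQ : ∀ m' ∈ Q.support, ∀ i, m' i ≠ 0 → i ∈ Q.vars := fun m' hm' i hi =>
    (mem_vars_iff_mem_support i).2 ⟨m', hm', Finsupp.mem_support_iff.2 hi⟩
  rw [mem_support_iff, coeff_mul, Finset.sum_eq_single (m, n)]
  · exact mul_ne_zero (mem_support_iff.1 hm) (mem_support_iff.1 hn)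
  · rintro ⟨m', n'⟩ hmn hne
    by_contra hcon
    have hm' : m' ∈ P.support := mem_support_iff.2 (left_ne_zero_of_mul hcon)
    have hn' : n' ∈ Q.support := mem_support_iff.2 (right_ne_zero_of_mul hcon)
    rw [Finset.HasAntidiagonal.mem_antidiagonal] at hmn
    have hmm : m' = m := by
      ext i
      have hi := DFunLike.congr_fun hmn i
      simp only [Finsupp.add_apply] at hi
      by_cases hiP : i ∈ P.vars
      · have hiQ := Finset.disjoint_left.1 hPQ hiP
        have h₁ : n i = 0 := by_contra fun h => hiQ (hzQ n hn i h)
        have h₂ : n' i = 0 := by_contra fun h => hiQ (hzQ n' hn' i h)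
        omega
      · have h₁ : m i = 0 := by_contra fun h => hiP (hzP m hm i h)
        have h₂ : m' i = 0 := by_contra fun h => hiP (hzP m' hm' i h)
        omega
    subst hmm
    exact hne (Prod.ext rfl (add_left_cancel hmn))
  · intro h
    exact absurd (Finset.HasAntidiagonal.mem_antidiagonal.2 (rfl : m + n = m + n)) h

/-- The factors of a multiaffine polynomial have no variable in common. -/
theorem disjoint_vars_of_multiaffine {P Q : MvPolynomial σ ℚ} (h0 : P * Q ≠ 0)
    (h : ∀ m ∈ (P * Q).support, ∀ i, m i ≤ 1) : Disjoint P.vars Q.vars := by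
  classical
  rw [Finset.disjoint_left]
  intro i hP hQ
  have hdeg : degreeOf i (P * Q) ≤ 1 := degreeOf_le_iff.2 fun m hm => h m hm i
  rw [degreeOf_mul_eq (left_ne_zero_of_mul h0) (right_ne_zero_of_mul h0)] at hdeg
  obtain ⟨m, hm, hmi⟩ := (mem_vars_iff_mem_support i).1 hP
  obtain ⟨n, hn, hni⟩ := (mem_vars_iff_mem_support i).1 hQ
  have h₁ := monomial_le_degreeOf i hm
  have h₂ := monomial_le_degreeOf i hn
  rw [Finsupp.mem_support_iff] at hmi hni
  omega

end Polynomial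

section Kirchhoff

open MvPolynomial

variable {V : Type*} {ε : Type*} {G : MultiDigraph V ε} {v : V}

theorem mem_support_kirchhoff {m : ε →₀ ℕ} :
    m ∈ G.kirchhoff.support ↔
      ∃ A, A ⊆ G.edges ∧ G.IsArb A ∧ ∑ e ∈ A, Finsupp.single e 1 = m := by
  classical
  have hmon : ∀ A : Finset ε, (∏ e ∈ A, X e : MvPolynomial ε ℚ) =
      monomial (∑ e ∈ A, Finsupp.single e 1) 1 := fun A => by
    rw [monomial_sum_one]; rfl
  simp only [mem_support_iff, kirchhoff, hmon, coeff_sum, coeff_monomial, Finset.sum_boole]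
  rw [Nat.cast_ne_zero, Finset.card_ne_zero]
  constructor
  · rintro ⟨A, hA⟩
    simp only [Finset.mem_filter, Finset.mem_powerset] at hA
    exact ⟨A, hA.1.1, hA.1.2, hA.2⟩
  · rintro ⟨A, hA⟩
    exact ⟨A, by simpa only [Finset.mem_filter, Finset.mem_powerset, and_assoc] using hA⟩

theorem sum_single_one_apply (A : Finset ε) (e : ε) [Decidable (e ∈ A)] :
    (∑ e' ∈ A, Finsupp.single e' 1 : ε →₀ ℕ) e = if e ∈ A then 1 else 0 := by
  classical
  simp [Finsupp.finsetSum_apply, Finsupp.single_apply]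

theorem IsArb.isArbAt {A : Finset ε} (hroot : G.RootedAt v) (hA : G.IsArb A) :
    G.IsArbAt A v := by
  obtain ⟨r, hr⟩ := hA
  obtain rfl : v = r := by
    by_contra hne
    obtain ⟨e, ⟨he, hev⟩, -⟩ := hr.2.2.2.2.1 v hroot.1 hne
    exact hroot.2.1 e (hr.1 he) hev
  exact hr

/-- The exponents of the Kirchhoff polynomial of a rooted digraph. -/
theorem exists_isArbAt_of_mem_support (hroot : G.RootedAt v) {m : ε →₀ ℕ}
    (hm : m ∈ G.kirchhoff.support) :
    ∃ A, G.IsArbAt A v ∧ (∀ e, m e ≤ 1) ∧ ∀ e, e ∈ A ↔ m e ≠ 0 := by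
  classical
  obtain ⟨A, -, hA, rfl⟩ := mem_support_kirchhoff.1 hm
  refine ⟨A, hA.isArbAt hroot, fun e => ?_, fun e => ?_⟩ <;> rw [sum_single_one_apply] <;>
    split <;> simp_all

/-- Every exponent of the Kirchhoff polynomial has degree one in the in-edges of each vertex
other than the root. -/
theorem sum_inEdges_of_mem_support [DecidableEq V] (hroot : G.RootedAt v) {m : ε →₀ ℕ}
    (hm : m ∈ G.kirchhoff.support) {w : V} (hw : w ∈ G.verts) (hwv : w ≠ v) :
    ∑ e ∈ G.inEdges w, m e = 1 := by
  obtain ⟨A, hA, hle, hmem⟩ := exists_isArbAt_of_mem_support hroot hm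
  obtain ⟨e, ⟨he, rfl⟩, huniq⟩ := hA.2.2.2.2.1 w hw hwv
  rw [Finset.sum_eq_single e]
  · have := hle e
    have := (hmem e).1 he
    omega
  · intro e' he' hne
    by_contra h
    exact hne (huniq e' ⟨(hmem e').2 h, (Finset.mem_filter.1 he').2⟩)
  · exact fun h => (h (Finset.mem_filter.2 ⟨hA.1 he, rfl⟩)).elim

end Kirchhoff
end MultiDigraph

variable {V : Type*} {ε : Type*} [DecidableEq V] [DecidableEq ε]

/-- If `G` is rooted at `v`, the induced subdigraph `G[V∖{v}]` is
strongly connected, and `G` has no non-trivial dominators, then `κ(G)` is prime. -/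
theorem statement_4 (G : MultiDigraph V ε) (hwf : G.WellFormed) (hsimple : G.Simple)
    (v : V) (hroot : G.RootedAt v)
    (hsc : (G.induce (G.verts.erase v)).StronglyConnected)
    (hdom : ∀ u ∈ G.verts, u ≠ v → ∀ w ∈ G.verts, G.Dominates v u w → w = u)
    (P Q : MvPolynomial ε ℚ) (hfac : G.kirchhoff = P * Q) :
    (∃ c : ℚ, P = MvPolynomial.C c) ∨ (∃ c : ℚ, Q = MvPolynomial.C c) := by
  classical
  obtain ⟨A₀, -, hA₀⟩ :=
    MultiDigraph.exists_isArbAt_subset hwf hroot (Finset.Subset.refl G.edges) hroot.2.2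
  have hsupp : ∀ A, G.IsArbAt A v → ∑ e ∈ A, Finsupp.single e 1 ∈ (P * Q).support := fun A hA =>
    hfac ▸ MultiDigraph.mem_support_kirchhoff.2 ⟨A, hA.1, ⟨v, hA⟩, rfl⟩
  have h0 : P * Q ≠ 0 := fun h => by simpa [h] using hsupp A₀ hA₀
  have hdisj : Disjoint P.vars Q.vars := MultiDigraph.disjoint_vars_of_multiaffine h0 fun m hm =>
    (MultiDigraph.exists_isArbAt_of_mem_support hroot (hfac ▸ hm)).choose_spec.2.1
  have hadd : ∀ m ∈ P.support, ∀ n ∈ Q.support, m + n ∈ G.kirchhoff.support := fun m hm n hn =>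
    hfac ▸ MultiDigraph.add_mem_support_mul hdisj hm hn
  obtain ⟨m₀, hm₀⟩ := support_nonempty.2 (left_ne_zero_of_mul h0)
  obtain ⟨n₀, hn₀⟩ := support_nonempty.2 (right_ne_zero_of_mul h0)
  have hdeg : ∀ m ∈ P.support, ∀ n ∈ Q.support, ∀ w ∈ G.verts, w ≠ v →
      ∑ e ∈ G.inEdges w, m e + ∑ e ∈ G.inEdges w, n e = 1 := by
    intro m hm n hn w hw hwv
    rw [← MultiDigraph.sum_inEdges_of_mem_support hroot (hadd m hm n hn) hw hwv,
      ← Finset.sum_add_distrib]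
    rfl
  have hedge : ∀ m ∈ P.support, ∀ n ∈ Q.support, ∀ e, (m + n) e ≠ 0 →
      e ∈ G.edges ∧ e ∈ G.inEdges (G.tgt e) ∧ G.tgt e ∈ G.verts ∧ G.tgt e ≠ v := by
    intro m hm n hn e he
    obtain ⟨A, hA, -, hmem⟩ :=
      MultiDigraph.exists_isArbAt_of_mem_support hroot (hadd m hm n hn)
    have heG := hA.1 ((hmem e).2 he)
    exact ⟨heG, Finset.mem_filter.2 ⟨heG, rfl⟩, (hwf e heG).2, hroot.2.1 e heG⟩
  let S : Set V := {w | ∑ e ∈ G.inEdges w, m₀ e = 1}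
  have hQ0 : ∀ m ∈ P.support, ∀ n ∈ Q.support, ∀ e, (m + n) e ≠ 0 → G.tgt e ∈ S → n e = 0 := by
    intro m hm n hn e he heS
    obtain ⟨-, hin, hw, hwv⟩ := hedge m hm n hn e he
    have h₁ := hdeg m₀ hm₀ n hn _ hw hwv
    have heS' : ∑ e' ∈ G.inEdges (G.tgt e), m₀ e' = 1 := heS
    have h₂ := Finset.single_le_sum (f := fun e => n e) (fun _ _ => Nat.zero_le _) hin
    omega
  have hP0 : ∀ m ∈ P.support, ∀ n ∈ Q.support, ∀ e, (m + n) e ≠ 0 → G.tgt e ∉ S → m e = 0 := by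
    intro m hm n hn e he heS
    obtain ⟨-, hin, hw, hwv⟩ := hedge m hm n hn e he
    have h₁ := hdeg m₀ hm₀ n₀ hn₀ _ hw hwv
    have h₃ := hdeg m hm n₀ hn₀ _ hw hwv
    have heS' : ∑ e' ∈ G.inEdges (G.tgt e), m₀ e' ≠ 1 := heS
    have h₂ := Finset.single_le_sum (f := fun e => m e) (fun _ _ => Nat.zero_le _) hin
    omega
  have hexch : ∀ A A', G.IsArbAt A v → G.IsArbAt A' v → ∃ M, G.IsArbAt M v ∧
      ∀ e ∈ M, (G.tgt e ∈ S → e ∈ A) ∧ (G.tgt e ∉ S → e ∈ A') := by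
    intro A A' hA hA'
    obtain ⟨m, hm, n, hn, hmn⟩ := Finset.mem_add.1 (support_mul P Q (hsupp A hA))
    obtain ⟨m', hm', n', hn', hmn'⟩ := Finset.mem_add.1 (support_mul P Q (hsupp A' hA'))
    obtain ⟨M, hM, -, hmem⟩ :=
      MultiDigraph.exists_isArbAt_of_mem_support hroot (hadd m hm n' hn')
    refine ⟨M, hM, fun e he => ?_⟩
    have he' := (hmem e).1 he
    have hAe := DFunLike.congr_fun hmn e
    have hAe' := DFunLike.congr_fun hmn' e
    rw [MultiDigraph.sum_single_one_apply] at hAe hAe'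
    simp only [Finsupp.add_apply] at hAe hAe'
    have hs : (m + n') e = m e + n' e := rfl
    constructor
    · intro heS
      have := hQ0 m hm n' hn' e he' heS
      by_contra hne
      rw [if_neg hne] at hAe
      omega
    · intro heS
      have := hP0 m hm n' hn' e he' heS
      by_contra hne
      rw [if_neg hne] at hAe'
      omega
  by_cases hex : ∃ s ∈ G.verts, s ≠ v ∧ s ∈ S
  · obtain ⟨s, hs, hsv, hsS⟩ := hex
    refine Or.inr ⟨_, totalDegree_eq_zero_iff_eq_C.1 ((totalDegree_eq_zero_iff _ _).2 ?_)⟩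
    intro n hn e
    by_contra hne
    have hne' : (m₀ + n) e ≠ 0 := by simp [hne]
    obtain ⟨-, -, hw, hwv⟩ := hedge m₀ hm₀ n hn e hne'
    exact hne (hQ0 m₀ hm₀ n hn e hne'
      (MultiDigraph.mem_of_exchange hwf hroot hsc hdom S hexch hs hsv hw hwv hsS))
  · refine Or.inl ⟨_, totalDegree_eq_zero_iff_eq_C.1 ((totalDegree_eq_zero_iff _ _).2 ?_)⟩
    intro m hm e
    by_contra hne
    have hne' : (m + n₀) e ≠ 0 := by simp [hne]
    obtain ⟨-, -, hw, hwv⟩ := hedge m hm n₀ hn₀ e hne'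
    exact hne (hP0 m hm n₀ hn₀ e hne' fun h => hex ⟨_, hw, hwv, h⟩)
end

section
/- Let G = (V, E) be a connected digraph whose strongly connected components are G[V₁], …, G[V_k], and suppose G has exactly one initial strongly connected component (exactly one minimal element in the partial order of SCCs induced by reachability). Then κ(G) = κ(Ĝ(V₁)) · κ(Ĝ(V₂)) · … · κ(Ĝ(V_k)). -/
open MvPolynomial

namespace MultiDigraph

variable {V : Type*} {ε : Type*}

theorem reaches_of_mem_edges (G : MultiDigraph V ε) {A : Finset ε} {e : ε} (he : e ∈ A) :
    G.Reaches A (G.src e) (G.tgt e) :=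
  Relation.ReflTransGen.single ⟨e, he, rfl, rfl⟩

theorem Reaches.mono {G : MultiDigraph V ε} {A B : Finset ε} (h : A ⊆ B) {x y : V}
    (hxy : G.Reaches A x y) : G.Reaches B x y := by
  refine Relation.ReflTransGen.mono ?_ x y hxy
  rintro a b ⟨e, he, h₁, h₂⟩
  exact ⟨e, h he, h₁, h₂⟩

theorem IsSCC.subset_verts {G : MultiDigraph V ε} {W : Finset V} (hW : G.IsSCC W) :
    W ⊆ G.verts := by
  classical
  obtain ⟨x, -, rfl⟩ := hW
  exact Finset.filter_subset _ _

theorem IsSCC.mem_iff {G : MultiDigraph V ε} {W : Finset V} (hW : G.IsSCC W) {x y : V}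
    (hx : x ∈ W) : y ∈ W ↔ y ∈ G.verts ∧ G.MutuallyReachable x y := by
  obtain ⟨z, -, rfl⟩ := hW
  simp only [Finset.mem_filter] at hx ⊢
  refine and_congr_right fun _ => ⟨fun h => ?_, fun h => ?_⟩
  · exact ⟨hx.2.2.trans h.1, h.2.trans hx.2.1⟩
  · exact ⟨hx.2.1.trans h.1, h.2.trans hx.2.2⟩

theorem IsSCC.nonempty {G : MultiDigraph V ε} {W : Finset V} (hW : G.IsSCC W) : W.Nonempty := by
  classical
  obtain ⟨x, hx, rfl⟩ := hW
  exact ⟨x, Finset.mem_filter.2 ⟨hx, .refl, .refl⟩⟩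

theorem IsSCC.eq_of_mem {G : MultiDigraph V ε} {W W' : Finset V} (hW : G.IsSCC W)
    (hW' : G.IsSCC W') {x : V} (hx : x ∈ W) (hx' : x ∈ W') : W = W' := by
  ext y
  rw [hW.mem_iff hx, hW'.mem_iff hx']

theorem exists_isSCC_mem (G : MultiDigraph V ε) {x : V} (hx : x ∈ G.verts) :
    ∃ W, G.IsSCC W ∧ x ∈ W := by
  classical
  exact ⟨_, ⟨x, hx, rfl⟩, Finset.mem_filter.2 ⟨hx, .refl, .refl⟩⟩

/-- An edge of `G` enters `W` from outside. -/
def HasEntering (G : MultiDigraph V ε) (W : Finset V) : Prop :=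
  ∃ e ∈ G.edges, G.tgt e ∈ W ∧ G.src e ∉ W

theorem Reaches.mem_of_not_hasEntering {G : MultiDigraph V ε} {W : Finset V}
    (hW : ¬ G.HasEntering W) {x y : V} (hxy : G.Reaches G.edges x y) (hy : y ∈ W) : x ∈ W := by
  induction hxy using Relation.ReflTransGen.head_induction_on with
  | refl => exact hy
  | head h _ ih =>
    obtain ⟨e, he, rfl, rfl⟩ := h
    by_contra hs
    exact hW ⟨e, he, ih, hs⟩

theorem isMinimalSCC_iff {G : MultiDigraph V ε} (hwf : G.WellFormed) {W : Finset V}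
    (hW : G.IsSCC W) : G.IsMinimalSCC W ↔ ¬ G.HasEntering W := by
  refine ⟨?_, fun h => ⟨hW, ?_⟩⟩
  · rintro ⟨-, h⟩ ⟨e, he, ht, hs⟩
    obtain ⟨W', hW', hm⟩ := G.exists_isSCC_mem (hwf e he).1
    have := h W' hW' ⟨_, hm, _, ht, G.reaches_of_mem_edges he⟩
    exact hs (this ▸ hm)
  · rintro W' hW' ⟨x, hx, y, hy, hxy⟩
    exact hW'.eq_of_mem hW hx (hxy.mem_of_not_hasEntering h hy)

section hatSCC

variable [DecidableEq V] {G : MultiDigraph V ε} {W : Finset V}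

theorem some_mem_hatSCC_verts {x : V} : some x ∈ (G.hatSCC W).verts ↔ x ∈ W := by
  unfold hatSCC
  dsimp only
  split_ifs <;> simp

theorem none_mem_hatSCC_verts : none ∈ (G.hatSCC W).verts ↔ G.HasEntering W := by
  unfold hatSCC HasEntering
  dsimp only
  split_ifs with h <;> simp only [h, Finset.mem_insert_self] ; simp

theorem mem_hatSCC_edges {e : ε} : e ∈ (G.hatSCC W).edges ↔ e ∈ G.edges ∧ G.tgt e ∈ W := by
  simp [hatSCC]

theorem hatSCC_tgt (e : ε) : (G.hatSCC W).tgt e = some (G.tgt e) := rfl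

theorem hatSCC_src_of_mem {e : ε} (h : G.src e ∈ W) : (G.hatSCC W).src e = some (G.src e) :=
  if_pos h

theorem hatSCC_src_of_notMem {e : ε} (h : G.src e ∉ W) : (G.hatSCC W).src e = none :=
  if_neg h

theorem hatSCC_src_mem {e : ε} (he : e ∈ G.edges) (ht : G.tgt e ∈ W) :
    (G.hatSCC W).src e ∈ (G.hatSCC W).verts := by
  by_cases h : G.src e ∈ W
  · rw [hatSCC_src_of_mem h]
    exact some_mem_hatSCC_verts.2 h
  · rw [hatSCC_src_of_notMem h]
    exact none_mem_hatSCC_verts.2 ⟨e, he, ht, h⟩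

/-- An arborescence of `Ĝ(W)` is rooted at the auxiliary vertex whenever the latter is present. -/
theorem IsArbAt.eq_none {A : Finset ε} {r : Option V} (h : (G.hatSCC W).IsArbAt A r)
    (hW : G.HasEntering W) : r = none := by
  by_contra hr
  obtain ⟨e, ⟨-, he⟩, -⟩ := h.2.2.2.2.1 none (none_mem_hatSCC_verts.2 hW) (Ne.symm hr)
  simp [hatSCC_tgt] at he

/-- The edges of an arborescence of `G` that end in an SCC form an arborescence of its hat. -/
theorem IsArb.hatSCC {A : Finset ε} (hA : G.IsArb A) (hwf : G.WellFormed) (hW : G.IsSCC W) :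
    (G.hatSCC W).IsArb (A.filter fun e => G.tgt e ∈ W) := by
  obtain ⟨r, hsub, hr, -, hroot, huniq, hreach⟩ := hA
  have hreachG : ∀ w ∈ G.verts, G.Reaches G.edges r w := fun w hw => (hreach w hw).mono hsub
  have hent : r ∉ W ↔ G.HasEntering W := by
    refine ⟨fun h => ?_, fun ⟨e, he, ht, hs⟩ h => hs ?_⟩
    · by_contra hne
      obtain ⟨w, hw⟩ := hW.nonempty
      exact h ((hreachG w (hW.subset_verts hw)).mem_of_not_hasEntering hne hw)
    · exact (hW.mem_iff h).2 ⟨(hwf e he).1, hreachG _ (hwf e he).1,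
        (G.reaches_of_mem_edges he).trans ((hW.mem_iff h).1 ht).2.2⟩
  obtain ⟨r', hr'V, hr'some, hr'none⟩ : ∃ r' ∈ (G.hatSCC W).verts,
      (∀ x ∈ W, some x = r' ↔ x = r) ∧ (r ∉ W → r' = none) := by
    by_cases h : r ∈ W
    · exact ⟨some r, some_mem_hatSCC_verts.2 h, by simp, fun h' => absurd h h'⟩
    · refine ⟨none, none_mem_hatSCC_verts.2 (hent.1 h), fun x hx => ?_, fun _ => rfl⟩
      simpa using fun hxr : x = r => h (hxr ▸ hx)
  have hnone : ∀ e ∈ G.edges, G.tgt e ∈ W → G.src e ∉ W → r' = none := fun e he ht hs =>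
    hr'none (hent.2 ⟨e, he, ht, hs⟩)
  have hsome : ∀ y, G.Reaches A r y → y ∈ W →
      (G.hatSCC W).Reaches (A.filter fun e => G.tgt e ∈ W) r' (some y) := by
    intro y hy
    induction hy with
    | refl =>
      intro hrW
      rw [(hr'some r hrW).2 rfl]
      exact .refl
    | tail _ hstep ih =>
      obtain ⟨e, he, rfl, rfl⟩ := hstep
      intro ht
      have hstep := (G.hatSCC W).reaches_of_mem_edges
        (A := A.filter fun e => G.tgt e ∈ W) (Finset.mem_filter.2 ⟨he, ht⟩)
      by_cases hs : G.src e ∈ W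
      · rw [hatSCC_src_of_mem hs] at hstep
        exact (ih hs).trans hstep
      · rw [hatSCC_src_of_notMem hs] at hstep
        rw [hnone e (hsub he) ht hs]
        exact hstep
  refine ⟨r', ?_, hr'V, ?_, ?_, ?_, ?_⟩
  · intro e he
    rw [Finset.mem_filter] at he
    exact mem_hatSCC_edges.2 ⟨hsub he.1, he.2⟩
  · intro e he
    rw [Finset.mem_filter] at he
    exact ⟨hatSCC_src_mem (hsub he.1) he.2, some_mem_hatSCC_verts.2 he.2⟩
  · intro e he h
    rw [Finset.mem_filter] at he
    exact hroot e he.1 ((hr'some _ he.2).1 h)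
  · intro w hw hne
    rcases w with _ | w
    · exact absurd (hr'none (hent.2 (none_mem_hatSCC_verts.1 hw))).symm hne
    · have hwW := some_mem_hatSCC_verts.1 hw
      obtain ⟨e, ⟨he, rfl⟩, hu⟩ :=
        huniq w (hW.subset_verts hwW) fun h => hne ((hr'some w hwW).2 h)
      exact ⟨e, ⟨Finset.mem_filter.2 ⟨he, hwW⟩, rfl⟩, fun e' he' =>
        hu e' ⟨(Finset.mem_filter.1 he'.1).1, Option.some_injective _ he'.2⟩⟩
  · intro w hw
    rcases w with _ | w
    · rw [hr'none (hent.2 (none_mem_hatSCC_verts.1 hw))]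
      exact .refl
    · have hwW := some_mem_hatSCC_verts.1 hw
      exact hsome w (hreach w (hW.subset_verts hwW)) hwW

end hatSCC

open Classical in
/-- The set of vertices from which `w` can be reached. -/
noncomputable def ancestors (G : MultiDigraph V ε) (w : V) : Finset V :=
  G.verts.filter fun x => G.Reaches G.edges x w

/-- The source of an edge entering an SCC has fewer ancestors than any vertex of the SCC. -/
theorem card_ancestors_src_lt {G : MultiDigraph V ε} (hwf : G.WellFormed) {W : Finset V}
    (hW : G.IsSCC W) {e : ε} (he : e ∈ G.edges) (ht : G.tgt e ∈ W) (hs : G.src e ∉ W) {w : V}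
    (hw : w ∈ W) : (G.ancestors (G.src e)).card < (G.ancestors w).card := by
  classical
  have hsw : G.Reaches G.edges (G.src e) w :=
    (G.reaches_of_mem_edges he).trans ((hW.mem_iff ht).1 hw).2.1
  refine Finset.card_lt_card (Finset.ssubset_iff_of_subset ?_ |>.2 ⟨w, ?_, fun h => hs ?_⟩)
  · intro x hx
    simp only [ancestors, Finset.mem_filter] at hx ⊢
    exact ⟨hx.1, hx.2.trans hsw⟩
  · exact Finset.mem_filter.2 ⟨hW.subset_verts hw, .refl⟩
  · exact (hW.mem_iff hw).2 ⟨(hwf e he).1, (Finset.mem_filter.1 h).2, hsw⟩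

/-- If `G` has a unique initial SCC, then a set of edges whose restriction to every SCC is an
arborescence of the hat of that SCC is an arborescence of `G`. -/
theorem isArb_of_forall_hatSCC [DecidableEq V] {G : MultiDigraph V ε} (hwf : G.WellFormed)
    (hinit : ∃! W, G.IsMinimalSCC W) {A : Finset ε} (hsub : A ⊆ G.edges)
    (hA : ∀ W, G.IsSCC W → (G.hatSCC W).IsArb (A.filter fun e => G.tgt e ∈ W)) :
    G.IsArb A := by
  obtain ⟨W₀, hmin, hunique⟩ := hinit
  have hW₀ := hmin.1
  have hno : ¬ G.HasEntering W₀ := (isMinimalSCC_iff hwf hW₀).1 hmin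
  have hent : ∀ W, G.IsSCC W → W ≠ W₀ → G.HasEntering W := fun W hW hne => by
    by_contra h
    exact hne (hunique W ((isMinimalSCC_iff hwf hW).2 h))
  obtain ⟨r₀, hr₀⟩ := hA W₀ hW₀
  obtain ⟨r, rfl⟩ : ∃ r, r₀ = some r := by
    rcases r₀ with _ | r
    · exact absurd (none_mem_hatSCC_verts.1 hr₀.2.1) hno
    · exact ⟨r, rfl⟩
  have hr : r ∈ W₀ := some_mem_hatSCC_verts.1 hr₀.2.1
  have hroot : ∀ W, G.IsSCC W → ∃ r', (G.hatSCC W).IsArbAt (A.filter fun e => G.tgt e ∈ W) r' ∧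
      (r' = none ∨ r' = some r) := by
    intro W hW
    rcases eq_or_ne W W₀ with rfl | hne
    · exact ⟨_, hr₀, .inr rfl⟩
    · obtain ⟨r', hr'⟩ := hA W hW
      exact ⟨r', hr', .inl (hr'.eq_none (hent W hW hne))⟩
  have hreach : ∀ n, ∀ w ∈ G.verts, (G.ancestors w).card = n → G.Reaches A r w := by
    intro n
    induction n using Nat.strong_induction_on with
    | _ n ih =>
      intro w hw hn
      obtain ⟨W, hW, hwW⟩ := G.exists_isSCC_mem hw
      obtain ⟨r', hr', hcase⟩ := hroot W hW
      have key : ∀ y, (G.hatSCC W).Reaches (A.filter fun e => G.tgt e ∈ W) r' y →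
          ∀ v, y = some v → G.Reaches A r v := by
        intro y hy
        induction hy with
        | refl =>
          rintro v rfl
          obtain rfl : v = r := by simpa using hcase
          exact .refl
        | tail _ hstep ihy =>
          obtain ⟨e, he, hsrc, rfl⟩ := hstep
          rintro v hv
          obtain rfl : G.tgt e = v := Option.some_injective _ hv
          obtain ⟨heA, ht⟩ := Finset.mem_filter.1 he
          refine Relation.ReflTransGen.trans ?_ (G.reaches_of_mem_edges heA)
          by_cases hs : G.src e ∈ W
          · exact ihy _ (by rw [← hsrc, hatSCC_src_of_mem hs])
          · exact ih _ (hn ▸ card_ancestors_src_lt hwf hW (hsub heA) ht hs hwW) _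
              (hwf e (hsub heA)).1 rfl
      exact key _ (hr'.2.2.2.2.2 _ (some_mem_hatSCC_verts.2 hwW)) w rfl
  refine ⟨r, hsub, hW₀.subset_verts hr, fun e he => hwf e (hsub he), ?_, ?_,
    fun w hw => hreach _ w hw rfl⟩
  · intro e he h
    exact hr₀.2.2.2.1 e (Finset.mem_filter.2 ⟨he, h ▸ hr⟩) (congrArg some h)
  · intro w hw hne
    obtain ⟨W, hW, hwW⟩ := G.exists_isSCC_mem hw
    obtain ⟨r', hr', hcase⟩ := hroot W hW
    have hne' : some w ≠ r' := by
      rcases hcase with rfl | rfl <;> simp [hne]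
    obtain ⟨e, ⟨he, het⟩, hu⟩ := hr'.2.2.2.2.1 (some w) (some_mem_hatSCC_verts.2 hwW) hne'
    have het' : G.tgt e = w := Option.some_injective _ het
    refine ⟨e, ⟨(Finset.mem_filter.1 he).1, het'⟩, fun e' ⟨he', ht'⟩ => hu e' ⟨?_, ?_⟩⟩
    · exact Finset.mem_filter.2 ⟨he', ht' ▸ hwW⟩
    · exact congrArg some ht'

end MultiDigraph

open MvPolynomial

variable {V : Type*} {ε : Type*} [DecidableEq V] [DecidableEq ε]

/-- If `G[V₁], …, G[V_k]` are all the strongly connected components of a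
connected digraph `G` having exactly one initial SCC, then
`κ(G) = κ(Ĝ(V₁)) ⋯ κ(Ĝ(V_k))`. -/
theorem statement_7 (G : MultiDigraph V ε) (hwf : G.WellFormed) (hsimple : G.Simple)
    (k : ℕ) (Vs : Fin k → Finset V)
    (hscc : ∀ i, G.IsSCC (Vs i)) (hall : ∀ W, G.IsSCC W → ∃ i, W = Vs i)
    (hinj : Function.Injective Vs)
    (hconn : G.WeaklyConnected)
    (hinit : ∃! W, G.IsMinimalSCC W) :
    G.kirchhoff = ∏ i : Fin k, (G.hatSCC (Vs i)).kirchhoff := by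
  classical
  have hdisj : ∀ {i j x}, x ∈ Vs i → x ∈ Vs j → i = j := fun hi hj =>
    hinj ((hscc _).eq_of_mem (hscc _) hi hj)
  have hcov : ∀ x ∈ G.verts, ∃ i, x ∈ Vs i := fun x hx => by
    obtain ⟨W, hW, hxW⟩ := G.exists_isSCC_mem hx
    obtain ⟨i, rfl⟩ := hall W hW
    exact ⟨i, hxW⟩
  have hglue : ∀ A ⊆ G.edges,
      (Finset.univ.biUnion fun i => A.filter fun e => G.tgt e ∈ Vs i) = A := by
    intro A hA
    ext e
    simp only [Finset.mem_biUnion, Finset.mem_univ, true_and, Finset.mem_filter]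
    refine ⟨fun ⟨_, h, _⟩ => h, fun h => ?_⟩
    obtain ⟨i, hi⟩ := hcov _ (hwf e (hA h)).2
    exact ⟨i, h, hi⟩
  have hcut : ∀ p : Fin k → Finset ε, (∀ i, p i ⊆ (G.hatSCC (Vs i)).edges) →
      ∀ i, ((Finset.univ.biUnion p).filter fun e => G.tgt e ∈ Vs i) = p i := by
    intro p hp i
    ext e
    simp only [Finset.mem_biUnion, Finset.mem_univ, true_and, Finset.mem_filter]
    refine ⟨fun ⟨⟨j, hj⟩, ht⟩ => ?_, fun h => ⟨⟨i, h⟩, (MultiDigraph.mem_hatSCC_edges.1 (hp i h)).2⟩⟩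
    obtain rfl := hdisj (MultiDigraph.mem_hatSCC_edges.1 (hp j hj)).2 ht
    exact hj
  unfold MultiDigraph.kirchhoff
  rw [Finset.prod_univ_sum]
  refine Finset.sum_bij' (fun A _ i => A.filter fun e => G.tgt e ∈ Vs i)
    (fun p _ => Finset.univ.biUnion p) ?_ ?_ ?_ ?_ ?_
  · intro A hA
    simp only [Finset.mem_filter, Finset.mem_powerset] at hA
    simp only [Fintype.mem_piFinset, Finset.mem_filter, Finset.mem_powerset]
    intro i
    have harb := hA.2.hatSCC hwf (hscc i)
    exact ⟨harb.choose_spec.1, harb⟩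
  · intro p hp
    simp only [Fintype.mem_piFinset, Finset.mem_filter, Finset.mem_powerset] at hp
    simp only [Finset.mem_filter, Finset.mem_powerset]
    have hsub : Finset.univ.biUnion p ⊆ G.edges :=
      Finset.biUnion_subset.2 fun i _ e he => (MultiDigraph.mem_hatSCC_edges.1 ((hp i).1 he)).1
    refine ⟨hsub, MultiDigraph.isArb_of_forall_hatSCC hwf hinit hsub fun W hW => ?_⟩
    obtain ⟨i, rfl⟩ := hall W hW
    rw [hcut p (fun i => (hp i).1) i]
    exact (hp i).2
  · intro A hA
    exact hglue A (Finset.mem_powerset.1 (Finset.mem_filter.1 hA).1)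
  · intro p hp
    simp only [Fintype.mem_piFinset, Finset.mem_filter, Finset.mem_powerset] at hp
    exact funext (hcut p fun i => (hp i).1)
  · intro A hA
    have hsub := Finset.mem_powerset.1 (Finset.mem_filter.1 hA).1
    conv_lhs => rw [← hglue A hsub]
    refine Finset.prod_biUnion fun i _ j _ hij => Finset.disjoint_left.2 fun e hi hj => hij ?_
    exact hdisj (Finset.mem_filter.1 hi).2 (Finset.mem_filter.1 hj).2
end
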